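/- Let H be a finite-dimensional Hopf algebra with the dual Chevalley property over a field of characteristic p > 0, N := exp₀(H₀) the exponent of its coradical, L := Lw(H) its Loewy length, and M a positive integer with p^M ≥ L. Then exp₀(H) divides N·p^M. -/

import Mathlib

open TensorProduct

noncomputable section

variable (k H : Type*) [CommRing k] [Ring H] [Bialgebra k H]

/-- Convolution product `f * g = m ∘ (f ⊗ g) ∘ Δ` on linear endomorphisms. -/
def conv (f g : Module.End k H) : Module.End k H :=
  LinearMap.mul' k H ∘ₗ TensorProduct.map f g ∘ₗ Coalgebra.comul

/-- The convolution unit `u ∘ ε`. -/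
def convOne : Module.End k H := (Algebra.linearMap k H) ∘ₗ Coalgebra.counit

/-- `convSeq F n = m_n ∘ (F 0 ⊗ F 1 ⊗ ⋯ ⊗ F (n-1)) ∘ Δ_n` (as an iterated convolution). -/
def convSeq : (ℕ → Module.End k H) → ℕ → Module.End k H
  | _, 0 => convOne k H
  | F, n + 1 => conv k H (F 0) (convSeq (fun j => F (j + 1)) n)

/-- The `n`-th Sweedler power `[n] = m_n ∘ Δ_n` as a linear endomorphism. -/
def sweedlerPow (n : ℕ) : Module.End k H := convSeq k H (fun _ => LinearMap.id) n

/-- The twisted Sweedler power `m_n ∘ (id ⊗ T ⊗ T² ⊗ ⋯ ⊗ T^(n-1)) ∘ Δ_n`. -/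
def twistPow (T : Module.End k H) (n : ℕ) : Module.End k H :=
  convSeq k H (fun j => T ^ j) n

/-- `exp₀(H)`: the least `n ≥ 1` with `[n] = u ∘ ε`, in `ℕ ∪ {∞}` (`sInf ∅ = ∞`). -/
def exp0 : ℕ∞ :=
  sInf {e : ℕ∞ | ∃ n : ℕ, e = n ∧ 0 < n ∧ sweedlerPow k H n = convOne k H}

/-- The `T`-twisted exponent: least `n ≥ 1` with
`m_n ∘ (id ⊗ T ⊗ ⋯ ⊗ T^(n-1)) ∘ Δ_n = u ∘ ε`, in `ℕ ∪ {∞}`.  For `T = S⁻²` this is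
`exp(H)` and for `T = S^(2i)` this is the twisted exponent `exp_{2i}(H)`. -/
def expAt (T : Module.End k H) : ℕ∞ :=
  sInf {e : ℕ∞ | ∃ n : ℕ, e = n ∧ 0 < n ∧ twistPow k H T n = convOne k H}

/-- `S` is a subcoalgebra: `Δ(S) ⊆ S ⊗ S` (as a subspace of `H ⊗ H`). -/
def IsSubcoalg (S : Submodule k H) : Prop :=
  ∀ s ∈ S, Coalgebra.comul (R := k) s ∈
    LinearMap.range (TensorProduct.map S.subtype S.subtype)

/-- `S` is a simple subcoalgebra: nonzero, a subcoalgebra, and with no proper nonzero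
subcoalgebras. -/
def IsSimpleSubcoalg (S : Submodule k H) : Prop :=
  S ≠ ⊥ ∧ IsSubcoalg k H S ∧ ∀ T ≤ S, IsSubcoalg k H T → T = ⊥ ∨ T = S

/-- The coradical `H₀`: the sum of all simple subcoalgebras. -/
def coradical : Submodule k H := sSup {S : Submodule k H | IsSimpleSubcoalg k H S}

/-- The image of `S ⊗ T` in `H ⊗ H`. -/
def tsub (S T : Submodule k H) : Submodule k (H ⊗[k] H) :=
  LinearMap.range (TensorProduct.map S.subtype T.subtype)

/-- The coradical filtration, `H_0 = H₀` and `H_n = Δ⁻¹(H ⊗ H_{n-1} + H₀ ⊗ H)`. -/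
def coradFilt : ℕ → Submodule k H
  | 0 => coradical k H
  | n + 1 => Submodule.comap (Coalgebra.comul (R := k))
      (tsub k H ⊤ (coradFilt n) ⊔ tsub k H (coradical k H) ⊤)

/-- The Loewy length: the least `l ≥ 1` with `H_{l-1} = H`. -/
def loewyLength : ℕ := sInf {l : ℕ | 0 < l ∧ coradFilt k H (l - 1) = ⊤}

/-- The dual Chevalley property: the coradical is a Hopf subalgebra, i.e. it contains `1`
and is closed under multiplication and the antipode. -/
def DualChevalley [HopfAlgebra k H] : Prop :=
  (1 : H) ∈ coradical k H ∧
  (∀ a ∈ coradical k H, ∀ b ∈ coradical k H, a * b ∈ coradical k H) ∧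
  (∀ a ∈ coradical k H, HopfAlgebra.antipode (R := k) a ∈ coradical k H)

theorem aux_sweedler (n : ℕ) :
    WithConv.toConv (sweedlerPow k H n) = (WithConv.toConv (LinearMap.id : H →ₗ[k] H)) ^ n := by
  induction n with
  | zero => rfl
  | succ n ih =>
    rw [pow_succ', ← ih]
    rfl

theorem aux_sweedler_one (n : ℕ) :
    sweedlerPow k H n = convOne k H ↔
      (WithConv.toConv (LinearMap.id : H →ₗ[k] H)) ^ n = 1 := by
  rw [← aux_sweedler]
  exact WithConv.toConv_injective.eq_iff.symm

theorem aux_kill (f g : H →ₗ[k] H) (S T : Submodule k H)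
    (h : (∀ x ∈ S, f x = 0) ∨ (∀ x ∈ T, g x = 0)) :
    tsub k H S T ≤ LinearMap.ker (LinearMap.mul' k H ∘ₗ TensorProduct.map f g) := by
  rintro _ ⟨z, rfl⟩
  induction z using TensorProduct.induction_on with
  | zero => simp
  | add a b ha hb => rw [map_add]; exact Submodule.add_mem _ ha hb
  | tmul a b =>
    rcases h with h | h
    · simp [h a a.2]
    · simp [h b b.2]

theorem aux_filt (f : WithConv (H →ₗ[k] H)) (hf : ∀ c ∈ coradical k H, f.ofConv c = 0) (n : ℕ) :
    ∀ c ∈ coradFilt k H n, (f ^ (n + 1)).ofConv c = 0 := by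
  induction n with
  | zero => intro c hc; rw [zero_add, pow_one]; exact hf c hc
  | succ n ih =>
    intro c hc
    rw [pow_succ']
    have h1 := sup_le (aux_kill k H f.ofConv (f ^ (n + 1)).ofConv ⊤ (coradFilt k H n) (Or.inr ih))
      (aux_kill k H f.ofConv (f ^ (n + 1)).ofConv (coradical k H) ⊤ (Or.inl hf))
    exact h1 hc

theorem aux_exp0 (n : ℕ) (hn : 0 < n) (h : sweedlerPow k H n = convOne k H) :
    exp0 k H ∣ (n : ℕ∞) := by
  set x := WithConv.toConv (LinearMap.id : H →ₗ[k] H) with hx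
  have hxn : x ^ n = 1 := (aux_sweedler_one k H n).1 h
  have hpos : 0 < orderOf x := orderOf_pos_iff.2 (isOfFinOrder_iff_pow_eq_one.2 ⟨n, hn, hxn⟩)
  have he : exp0 k H = (orderOf x : ℕ∞) := by
    apply le_antisymm
    · exact sInf_le ⟨orderOf x, rfl, hpos, (aux_sweedler_one k H _).2 (pow_orderOf_eq_one x)⟩
    · apply le_sInf
      rintro _ ⟨m, rfl, hm, hm'⟩
      exact_mod_cast orderOf_le_of_pow_eq_one hm ((aux_sweedler_one k H m).1 hm')
  rw [he]
  exact_mod_cast Nat.cast_dvd_cast (α := ℕ∞) (orderOf_dvd_of_pow_eq_one hxn)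

/-- let `H` be a finite-dimensional Hopf algebra with the dual Chevalley
property over a field of characteristic `p > 0`, `N = exp₀(H₀)` (finite), `L = Lw(H)` its
Loewy length (finite), and `M ≥ 1` with `p^M ≥ L`.  Then `exp₀(H) ∣ N·p^M`.
Here `exp₀(H₀)` is the least `n ≥ 1` such that `[n] = u∘ε` holds on the coradical. -/
theorem stmt17 (k H : Type*) [Field k] [Ring H] [HopfAlgebra k H] [FiniteDimensional k H]
    (p : ℕ) [CharP k p] (hp : 0 < p)
    (hchev : DualChevalley k H)
    (N : ℕ)
    (hN : N = sInf {n : ℕ | 0 < n ∧ ∀ c ∈ coradical k H,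
      sweedlerPow k H n c = algebraMap k H (Coalgebra.counit (R := k) c)})
    (hNfin : ∃ n : ℕ, 0 < n ∧ ∀ c ∈ coradical k H,
      sweedlerPow k H n c = algebraMap k H (Coalgebra.counit (R := k) c))
    (hLfin : ∃ l : ℕ, 0 < l ∧ coradFilt k H (l - 1) = ⊤)
    (M : ℕ) (hM : 0 < M) (hpM : loewyLength k H ≤ p ^ M) :
    exp0 k H ∣ ((N * p ^ M : ℕ) : ℕ∞) := by
  have hNm := Nat.sInf_mem (s := {n : ℕ | 0 < n ∧ ∀ c ∈ coradical k H,
      sweedlerPow k H n c = algebraMap k H (Coalgebra.counit (R := k) c)}) hNfin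
  rw [← hN] at hNm
  obtain ⟨hN0, hNc⟩ := hNm
  have hLm := Nat.sInf_mem (s := {l : ℕ | 0 < l ∧ coradFilt k H (l - 1) = ⊤}) hLfin
  change 0 < loewyLength k H ∧ coradFilt k H (loewyLength k H - 1) = ⊤ at hLm
  obtain ⟨hL0, hL⟩ := hLm
  have hprime : p.Prime := (CharP.char_is_prime_or_zero k p).resolve_right hp.ne'
  haveI : Fact p.Prime := ⟨hprime⟩
  haveI hnt : Nontrivial (WithConv (H →ₗ[k] H)) := by
    refine ⟨⟨1, 0, fun h => ?_⟩⟩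
    have h1 : (1 : WithConv (H →ₗ[k] H)).ofConv 1 = 0 := by rw [h]; rfl
    rw [LinearMap.convOne_apply, Bialgebra.counit_one, map_one] at h1
    have h2 := congrArg (Coalgebra.counit (R := k)) h1
    rw [Bialgebra.counit_one, map_zero] at h2
    exact one_ne_zero h2
  haveI : CharP (WithConv (H →ₗ[k] H)) p :=
    charP_of_injective_algebraMap (algebraMap k (WithConv (H →ₗ[k] H))).injective p
  set x := WithConv.toConv (LinearMap.id : H →ₗ[k] H) with hx
  have hf : ∀ c ∈ coradical k H, (x ^ N - 1).ofConv c = 0 := by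
    intro c hc
    rw [hx, ← aux_sweedler, WithConv.ofConv_sub, LinearMap.sub_apply, LinearMap.convOne_apply]
    exact sub_eq_zero.2 (hNc c hc)
  have hzero : (x ^ N - 1) ^ loewyLength k H = 0 := by
    have h := aux_filt k H _ hf (loewyLength k H - 1)
    rw [Nat.sub_add_cancel hL0, hL] at h
    apply WithConv.ofConv_injective
    ext c
    exact h c trivial
  have hz2 : (x ^ N - 1) ^ p ^ M = 0 := pow_eq_zero_of_le hpM hzero
  rw [sub_pow_char_pow_of_commute (p := p) M (Commute.one_right _), one_pow, ← pow_mul, sub_eq_zero] at hz2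
  exact aux_exp0 k H _ (Nat.mul_pos hN0 (pow_pos hp M)) ((aux_sweedler_one k H _).2 hz2)
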